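/- arXiv:2007.00967 — 2 statements merged into one kernel-verified Lean document; each statement's English description precedes it below -/
import Mathlib

section
/- Fix a prime p. Let G be a finite group with Sylow p-subgroup P such that (∏_{x ∈ P} λ_G(x))^p > n_p(G)^{|P|} (i.e., G violates inequality (2)), and suppose that every finite group of order strictly smaller than |G| satisfies (∏_{x ∈ Q} λ(x))^p ≤ n_p^{|Q|} for its Sylow p-subgroup Q. Then: G is not solvable; G has a unique minimal normal subgroup M; M is not solvable; and G = MP (i.e., M together with P generate G and every element of G is a product of an element of M and an element of P). -/
open Subgroup

/-- `λ_G(x)`: the number of Sylow `p`-subgroups of `G` containing `x`. -/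
noncomputable def sylCount (p : ℕ) {G : Type*} [Group G] (x : G) : ℕ :=
  Nat.card {Q : Sylow p G // x ∈ Q}


lemma aux_count {A B : Type*} [Finite A] [Finite B] (f : A → B)
    (h : ∀ b b', Nat.card {a // f a = b} ≤ Nat.card {a // f a = b'}) (S : B → Prop) :
    Nat.card {a // S (f a)} * Nat.card B = Nat.card A * Nat.card {b // S b} := by
  classical
  have := Fintype.ofFinite B
  rcases isEmpty_or_nonempty B with hB | ⟨⟨b0⟩⟩
  · simp
  have hc : ∀ b, Nat.card {a // f a = b} = Nat.card {a // f a = b0} :=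
    fun b => le_antisymm (h _ _) (h _ _)
  have h1 : Nat.card {a // S (f a)} = Nat.card {b // S b} * Nat.card {a // f a = b0} := by
    rw [← Nat.card_congr (Equiv.sigmaSubtypeFiberEquivSubtype f
      (p := fun a => S (f a)) (q := S) (fun _ => Iff.rfl)), Nat.card_sigma]
    simp [hc]
  have h2 : Nat.card A = Nat.card B * Nat.card {a // f a = b0} := by
    rw [← Nat.card_congr (Equiv.sigmaFiberEquiv f), Nat.card_sigma]
    simp [hc]
  rw [h1, h2]; ring

lemma mem_smul_syl {p : ℕ} {G : Type*} [Group G] (g x : G) (Q : Sylow p G) :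
    x ∈ g • Q ↔ g⁻¹ * x * g ∈ Q := by
  constructor
  · rintro ⟨a, ha, rfl⟩
    simpa [mul_assoc] using ha
  · intro h
    exact ⟨_, h, by simp [mul_assoc]⟩

lemma lam_inj {p : ℕ} [Fact p.Prime] {H L : Type*} [Group H] [Group L] [Finite H] [Finite L]
    (i : H →* L) (hi : Function.Injective i)
    (ht : ∀ Q Q' : Sylow p L, ∃ h : H, i h • Q = Q') (x : H) :
    sylCount p (i x) * Nat.card (Sylow p H) = Nat.card (Sylow p L) * sylCount p x := by
  have hex : ∀ Q : Sylow p L, ∃ S : Sylow p H, ∀ y, y ∈ S ↔ i y ∈ Q := by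
    intro Q
    obtain ⟨S0⟩ := (inferInstance : Nonempty (Sylow p H))
    obtain ⟨Q0, hQ0⟩ := S0.exists_comap_eq_of_injective hi
    obtain ⟨h, rfl⟩ := ht Q0 Q
    refine ⟨h • S0, fun y => ?_⟩
    rw [mem_smul_syl, mem_smul_syl, ← map_inv, ← map_mul, ← map_mul]
    have := SetLike.ext_iff.1 hQ0 (h⁻¹ * y * h)
    exact this.symm
  choose f hf using hex
  have key : ∀ (h : H) (Q : Sylow p L), f (i h • Q) = h • f Q := by
    intro h Q
    apply SetLike.ext
    intro y
    rw [hf, mem_smul_syl, mem_smul_syl, hf]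
    simp
  have := aux_count f (by
    intro b b'
    obtain ⟨h, rfl⟩ := MulAction.exists_smul_eq H b b'
    refine Nat.card_le_card_of_injective (fun a => ⟨i h • a.1, by rw [key, a.2]⟩) ?_
    intro a a' e
    have := congrArg Subtype.val e
    exact Subtype.ext (MulAction.injective (i h) this)) (fun S => x ∈ S)
  unfold sylCount
  simpa only [hf] using this

lemma lam_sub {p : ℕ} [Fact p.Prime] {G : Type*} [Group G] [Finite G] (P : Sylow p G)
    (K : Subgroup G) (hPK : (P : Subgroup G) ≤ K) :
    ∃ e : {Q : Sylow p G // (Q : Subgroup G) ≤ K} ≃ Sylow p K,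
      ∀ Q (y : K), y ∈ e Q ↔ (y : G) ∈ Q.1 := by
  refine ⟨Equiv.ofBijective (fun Q => Q.1.subtype Q.2) ⟨?_, ?_⟩, ?_⟩
  · intro Q Q' h
    exact Subtype.ext (Sylow.subtype_injective h)
  · intro S
    obtain ⟨k, rfl⟩ := MulAction.exists_smul_eq K (P.subtype hPK) S
    exact ⟨⟨(k : G) • P, Sylow.smul_le hPK k⟩, (Sylow.smul_subtype hPK k).symm⟩
  · intro Q y
    rfl

section quot
variable {p : ℕ} [Fact p.Prime] {G : Type*} [Group G] [Finite G] (N : Subgroup G) [N.Normal]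

/-- The image of a Sylow subgroup in a quotient. -/
noncomputable def PhiS (Q : Sylow p G) : Sylow p (G ⧸ N) :=
  Q.mapSurjective (QuotientGroup.mk'_surjective N)

/-- The preimage of a Sylow subgroup of a quotient. -/
def Kpre (R : Sylow p (G ⧸ N)) : Subgroup G := (R : Subgroup (G ⧸ N)).comap (QuotientGroup.mk' N)

lemma mem_PhiS (Q : Sylow p G) (y : G ⧸ N) : y ∈ PhiS N Q ↔ ∃ q ∈ Q, (q : G ⧸ N) = y := Iff.rfl

lemma mem_Kpre (R : Sylow p (G ⧸ N)) (y : G) : y ∈ Kpre N R ↔ (y : G ⧸ N) ∈ R := Iff.rfl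

lemma PhiS_surj : Function.Surjective (PhiS (p := p) N) :=
  Sylow.mapSurjective_surjective (QuotientGroup.mk'_surjective N) p

lemma PhiS_smul (g : G) (Q : Sylow p G) : PhiS N (g • Q) = (g : G ⧸ N) • PhiS N Q := by
  apply SetLike.ext
  intro y
  rw [mem_smul_syl, mem_PhiS, mem_PhiS]
  constructor
  · rintro ⟨q, hq, rfl⟩
    rw [mem_smul_syl] at hq
    exact ⟨_, hq, by simp⟩
  · rintro ⟨q, hq, h⟩
    refine ⟨g * q * g⁻¹, ?_, ?_⟩
    · rw [mem_smul_syl]; simpa [mul_assoc] using hq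
    · simp [h, mul_assoc]

lemma PhiS_eq_iff (Q : Sylow p G) (R : Sylow p (G ⧸ N)) :
    PhiS N Q = R ↔ (Q : Subgroup G) ≤ Kpre N R := by
  constructor
  · rintro rfl q hq
    exact ⟨q, hq, rfl⟩
  · intro h
    refine Sylow.ext ?_
    refine ((PhiS N Q).is_maximal' R.isPGroup' ?_).symm
    rintro _ ⟨q, hq, rfl⟩
    exact h hq

lemma fib_le (R R' : Sylow p (G ⧸ N)) :
    Nat.card {Q : Sylow p G // PhiS N Q = R} ≤ Nat.card {Q : Sylow p G // PhiS N Q = R'} := by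
  obtain ⟨Q, rfl⟩ := PhiS_surj N R
  obtain ⟨Q', rfl⟩ := PhiS_surj N R'
  obtain ⟨g, rfl⟩ := MulAction.exists_smul_eq G Q Q'
  refine Nat.card_le_card_of_injective (fun a => ⟨g • a.1, by rw [PhiS_smul, PhiS_smul, a.2]⟩) ?_
  intro a a' e
  have := congrArg Subtype.val e
  exact Subtype.ext (MulAction.injective g this)

lemma card_Kpre (R : Sylow p (G ⧸ N)) :
    Nat.card (Sylow p (Kpre N R)) = Nat.card {Q : Sylow p G // PhiS N Q = R} := by
  obtain ⟨Q, hQ⟩ := PhiS_surj N R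
  obtain ⟨e, -⟩ := lam_sub Q (Kpre N R) ((PhiS_eq_iff N Q R).1 hQ)
  rw [← Nat.card_congr e]
  simp only [PhiS_eq_iff]

lemma lam_Kpre (R : Sylow p (G ⧸ N)) (x : G) (hx : x ∈ Kpre N R) :
    sylCount p (⟨x, hx⟩ : Kpre N R) = Nat.card {Q : Sylow p G // PhiS N Q = R ∧ x ∈ Q} := by
  obtain ⟨Q, hQ⟩ := PhiS_surj N R
  obtain ⟨e, he⟩ := lam_sub Q (Kpre N R) ((PhiS_eq_iff N Q R).1 hQ)
  simp only [PhiS_eq_iff]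
  unfold sylCount
  refine Nat.card_congr ?_
  refine (Equiv.subtypeEquiv e (p := fun Q => x ∈ Q.1) ?_).symm.trans
    (Equiv.subtypeSubtypeEquivSubtypeInter _ (fun Q : Sylow p G => x ∈ Q))
  intro Q
  rw [he]

lemma Kpre_trans (R : Sylow p (G ⧸ N)) (S S' : Sylow p (Kpre N R)) :
    ∃ n : Kpre N R, (n : G) ∈ N ∧ n • S = S' := by
  obtain ⟨Q, hQ⟩ := PhiS_surj N R
  obtain ⟨e, he⟩ := lam_sub Q (Kpre N R) ((PhiS_eq_iff N Q R).1 hQ)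
  obtain ⟨k, rfl⟩ := MulAction.exists_smul_eq (Kpre N R) S S'
  obtain ⟨Q1, rfl⟩ := e.surjective S
  have h1 : PhiS N Q1.1 = R := (PhiS_eq_iff N _ R).2 Q1.2
  have h2 : ((k : G) : G ⧸ N) ∈ PhiS N Q1.1 := by rw [h1]; exact k.2
  obtain ⟨q, hq, hqk⟩ := h2
  have hqK : q ∈ Kpre N R := Q1.2 hq
  refine ⟨k * ⟨q, hqK⟩⁻¹, ?_, ?_⟩
  · have : ((k * q⁻¹ : G) : G ⧸ N) = 1 := by
      rw [QuotientGroup.mk_mul, QuotientGroup.mk_inv]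
      rw [← hqk]; exact mul_inv_cancel _
    exact (QuotientGroup.eq_one_iff _).1 this
  · rw [mul_smul]
    congr 1
    rw [Sylow.smul_eq_iff_mem_normalizer]
    apply inv_mem
    exact Subgroup.le_normalizer ((he Q1 ⟨q, hqK⟩).2 hq)

lemma lam_const (R R' : Sylow p (G ⧸ N)) (x : G) (hx : x ∈ Kpre N R) (hx' : x ∈ Kpre N R') :
    sylCount p (⟨x, hx⟩ : Kpre N R) = sylCount p (⟨x, hx'⟩ : Kpre N R') := by
  set H : Subgroup G := N ⊔ Subgroup.zpowers x with hH
  have hxH : x ∈ H := (le_sup_right : _ ≤ H) (Subgroup.mem_zpowers x)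
  have key : ∀ (R : Sylow p (G ⧸ N)) (hx : x ∈ Kpre N R),
      sylCount p (⟨x, hx⟩ : Kpre N R) * Nat.card (Sylow p H)
        = Nat.card (Sylow p (Kpre N R)) * sylCount p (⟨x, hxH⟩ : H) := by
    intro R hx
    have hle : H ≤ Kpre N R := by
      refine sup_le ?_ ?_
      · intro n hn
        rw [mem_Kpre, (QuotientGroup.eq_one_iff n).2 hn]
        exact one_mem _
      · rwa [Subgroup.zpowers_le]
    refine lam_inj (Subgroup.inclusion hle) (Subgroup.inclusion_injective hle) ?_ ⟨x, hxH⟩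
    intro Q Q'
    obtain ⟨n, hn, h⟩ := Kpre_trans N R Q Q'
    exact ⟨⟨n, (le_sup_left : N ≤ H) hn⟩, h⟩
  have h1 := key R hx
  have h2 := key R' hx'
  have h3 : Nat.card (Sylow p (Kpre N R)) = Nat.card (Sylow p (Kpre N R')) := by
    rw [card_Kpre, card_Kpre]
    exact le_antisymm (fib_le N _ _) (fib_le N _ _)
  rw [h3, ← h2] at h1
  exact Nat.eq_of_mul_eq_mul_right Nat.card_pos h1

lemma card_factor (P : Sylow p G) :
    Nat.card (Sylow p G) =
      Nat.card (Sylow p (G ⧸ N)) * Nat.card (Sylow p (Kpre N (PhiS N P))) := by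
  classical
  have := Fintype.ofFinite (Sylow p (G ⧸ N))
  rw [← Nat.card_congr (Equiv.sigmaFiberEquiv (PhiS (p := p) N)), Nat.card_sigma, card_Kpre,
    Finset.sum_congr rfl (fun R _ => le_antisymm (fib_le N R (PhiS N P)) (fib_le N _ _))]
  simp

lemma lam_factor (P : Sylow p G) (x : G) (hx : x ∈ Kpre N (PhiS N P)) :
    sylCount p x =
      sylCount p (x : G ⧸ N) * sylCount p (⟨x, hx⟩ : Kpre N (PhiS N P)) := by
  classical
  have := Fintype.ofFinite {R : Sylow p (G ⧸ N) // (x : G ⧸ N) ∈ R}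
  let f : {Q : Sylow p G // x ∈ Q} → {R : Sylow p (G ⧸ N) // (x : G ⧸ N) ∈ R} :=
    fun Q => ⟨PhiS N Q.1, ⟨x, Q.2, rfl⟩⟩
  have h1 : ∀ R, Nat.card {a // f a = R} = sylCount p (⟨x, hx⟩ : Kpre N (PhiS N P)) := by
    intro R
    have hR : x ∈ Kpre N R.1 := R.2
    rw [lam_const N (PhiS N P) R.1 x hx hR, lam_Kpre]
    refine Nat.card_congr ⟨fun a => ⟨a.1.1, congrArg Subtype.val a.2, a.1.2⟩,
      fun a => ⟨⟨a.1, a.2.2⟩, Subtype.ext a.2.1⟩, fun _ => rfl, fun _ => rfl⟩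
  unfold sylCount at h1 ⊢
  rw [← Nat.card_congr (Equiv.sigmaFiberEquiv f), Nat.card_sigma]
  simp [h1]

end quot

lemma prod_surj {A B : Type*} [Group A] [Group B] [Fintype A] [Fintype B] (φ : A →* B)
    (hφ : Function.Surjective φ) (F : B → ℕ) :
    ∃ c : ℕ, ∏ a, F (φ a) = (∏ b, F b) ^ c ∧ Nat.card B * c = Nat.card A := by
  classical
  have hc : ∀ b, (Finset.univ.filter (fun a => φ a = b)).card
      = (Finset.univ.filter (fun a => φ a = 1)).card := fun b =>
    MonoidHom.card_fiber_eq_of_mem_range φ (hφ b) (hφ 1)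
  refine ⟨(Finset.univ.filter (fun a => φ a = 1)).card, ?_, ?_⟩
  · rw [Finset.prod_comp, Finset.image_univ_of_surjective hφ]
    simp only [hc]
    rw [Finset.prod_pow]
  · have h := Finset.card_eq_sum_card_fiberwise (f := φ) (s := Finset.univ) (t := Finset.univ)
      (by simp)
    rw [Nat.card_eq_fintype_card, Nat.card_eq_fintype_card (α := A), ← Finset.card_univ (α := A), h]
    simp [hc]

lemma finprod_conv {p : ℕ} {G : Type*} [Group G] (Q : Sylow p G)
    [Fintype (Q : Subgroup G)] (F : G → ℕ) :
    ∏ᶠ x ∈ ((Q : Subgroup G) : Set G), F x = ∏ x : (Q : Subgroup G), F x := by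
  rw [← finprod_eq_prod_of_fintype]
  exact (finprod_set_coe_eq_finprod_mem _).symm

lemma ineq_reduce {p : ℕ} [Fact p.Prime] {G : Type*} [Group G] [Finite G] (N : Subgroup G)
    [N.Normal] (P : Sylow p G)
    (h1 : ∀ Q : Sylow p (G ⧸ N), (∏ᶠ x ∈ ((Q : Subgroup (G ⧸ N)) : Set (G ⧸ N)), sylCount p x) ^ p ≤
      Nat.card (Sylow p (G ⧸ N)) ^ Nat.card (Q : Subgroup (G ⧸ N)))
    (h2 : ∀ Q : Sylow p (Kpre N (PhiS N P)),
      (∏ᶠ x ∈ ((Q : Subgroup (Kpre N (PhiS N P))) : Set (Kpre N (PhiS N P))), sylCount p x) ^ p ≤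
      Nat.card (Sylow p (Kpre N (PhiS N P))) ^ Nat.card (Q : Subgroup (Kpre N (PhiS N P)))) :
    (∏ᶠ x ∈ ((P : Subgroup G) : Set G), sylCount p x) ^ p ≤
      Nat.card (Sylow p G) ^ Nat.card (P : Subgroup G) := by
  classical
  have := Fintype.ofFinite (P : Subgroup G)
  have := Fintype.ofFinite (PhiS N P : Subgroup (G ⧸ N))
  have hPK : (P : Subgroup G) ≤ Kpre N (PhiS N P) := (PhiS_eq_iff N P _).1 rfl
  have := Fintype.ofFinite (P.subtype hPK : Subgroup (Kpre N (PhiS N P)))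
  have h1' := h1 (PhiS N P)
  have h2' := h2 (P.subtype hPK)
  rw [finprod_conv] at h1' h2' ⊢
  let φ : (P : Subgroup G) →* (PhiS N P : Subgroup (G ⧸ N)) :=
    ((QuotientGroup.mk' N).comp (P : Subgroup G).subtype).codRestrict _ (fun x => ⟨x, x.2, rfl⟩)
  have hφ : Function.Surjective φ := by
    rintro ⟨_, q, hq, rfl⟩
    exact ⟨⟨q, hq⟩, rfl⟩
  obtain ⟨c, hc1, hc2⟩ := prod_surj φ hφ (fun y => sylCount p (y : G ⧸ N))
  let e : (P.subtype hPK : Subgroup (Kpre N (PhiS N P))) ≃* (P : Subgroup G) :=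
    Subgroup.subgroupOfEquivOfLe hPK
  have e1 : ∏ x : (P.subtype hPK : Subgroup (Kpre N (PhiS N P))), sylCount p (x : Kpre N (PhiS N P))
      = ∏ x : (P : Subgroup G), sylCount p (⟨x, hPK x.2⟩ : Kpre N (PhiS N P)) :=
    Fintype.prod_equiv e.toEquiv _ _ (fun x => rfl)
  have e2 : Nat.card (P.subtype hPK : Subgroup (Kpre N (PhiS N P))) = Nat.card (P : Subgroup G) :=
    Nat.card_congr e.toEquiv
  rw [e1, e2] at h2'
  rw [Finset.prod_congr rfl (fun (x : (P : Subgroup G)) _ => lam_factor N P x (hPK x.2)),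
    Finset.prod_mul_distrib, mul_pow, card_factor N P, mul_pow]
  refine Nat.mul_le_mul ?_ h2'
  have e3 : ∏ x : (P : Subgroup G), sylCount p ((x : G) : G ⧸ N) =
      (∏ b : (PhiS N P : Subgroup (G ⧸ N)), sylCount p (b : G ⧸ N)) ^ c := hc1
  rw [e3, ← hc2, pow_mul, ← pow_mul, mul_comm c p, pow_mul]
  exact Nat.pow_le_pow_left h1' c

lemma indep_aux {V : Type*} [CommGroup V] {p : ℕ} [hp : Fact p.Prime] (X Z : MulAut V)
    (hc : Commute X Z) (hZ : Z ^ p = 1) (hfix : ∀ v, Z v = v → v = 1)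
    (htor : ∀ v : V, v ^ p = 1 → v = 1) (w : Fin p → V)
    (hw : ∀ i : Fin p, (X * Z ^ (i : ℕ)) (w i) = w i) (hprod : ∏ i, w i = 1) (j : Fin p) : w j = 1 := by
  have hstab : ∀ (A : MulAut V) (v : V), A v = v → ∀ k : ℤ, (A ^ k) v = v := by
    intro A v h k
    have : A ∈ MulAction.stabilizer (MulAut V) v := h
    exact (zpow_mem this k : A ^ k ∈ MulAction.stabilizer (MulAut V) v)
  have h1 : ∀ (m : ℕ) (i : Fin p), (X ^ m) (w i) = (((Z ^ (i : ℕ)) ^ m)⁻¹) (w i) := by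
    intro m i
    have e := hstab _ _ (hw i) m
    rw [zpow_natCast, (hc.pow_right _).mul_pow, ((hc.pow_right (i : ℕ)).pow_pow m m).eq,
      MulAut.mul_apply] at e
    nth_rewrite 2 [← e]
    rw [← MulAut.mul_apply, inv_mul_cancel, MulAut.one_apply]
  let Y : Fin p → MulAut V := fun i => Z ^ (j : ℕ) * (Z ^ (i : ℕ))⁻¹
  have hY : ∀ i, Y i = Z ^ ((j : ℤ) - (i : ℤ)) := by
    intro i
    simp [Y, zpow_sub]
  have h2 : ∀ m : ℕ, ∏ i, (Y i ^ m) (w i) = 1 := by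
    intro m
    have e := congrArg (fun v => ((Z ^ (j : ℕ)) ^ m) ((X ^ m) v)) hprod
    simp only [map_prod, map_one] at e
    rw [← e]
    refine Finset.prod_congr rfl fun i _ => ?_
    rw [h1, ← MulAut.mul_apply]
    congr 1
    have : Commute (Z ^ (j : ℕ)) (Z ^ (i : ℕ))⁻¹ := (Commute.pow_pow (Commute.refl Z) _ _).inv_right
    simp only [Y]
    rw [this.mul_pow, inv_pow]
  have h3 : ∏ i, ∏ m ∈ Finset.range p, (Y i ^ m) (w i) = 1 := by
    rw [Finset.prod_comm]
    exact Finset.prod_eq_one fun m _ => h2 m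
  have h4 : ∀ i, i ≠ j → ∏ m ∈ Finset.range p, (Y i ^ m) (w i) = 1 := by
    intro i hij
    set u := ∏ m ∈ Finset.range p, (Y i ^ m) (w i) with hu
    have hYp : Y i ^ p = 1 := by
      rw [hY, ← zpow_natCast, ← zpow_mul, mul_comm, zpow_mul, zpow_natCast, hZ, one_zpow]
    have hYu : Y i u = u := by
      have a := Finset.prod_range_succ (fun m => (Y i ^ m) (w i)) p
      rw [Finset.prod_range_succ'] at a
      rw [hYp, pow_zero] at a
      have b := mul_right_cancel a
      rw [← hu] at b
      conv_rhs => rw [← b]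
      rw [hu, map_prod]
      refine Finset.prod_congr rfl fun m _ => ?_
      rw [pow_succ' (Y i) m]
      rfl
    apply hfix
    have hcop : IsCoprime ((j : ℤ) - (i : ℤ)) (p : ℤ) := by
      rw [isCoprime_comm, (Nat.prime_iff_prime_int.1 hp.out).coprime_iff_not_dvd]
      intro hd
      have hi := i.2
      have hj := j.2
      have := Int.eq_zero_of_abs_lt_dvd hd (by rw [abs_lt]; omega)
      exact hij (Fin.ext (by omega))
    obtain ⟨a, b, hab⟩ := hcop
    have hZ1 : Z = Y i ^ a := by
      rw [hY, ← zpow_mul, mul_comm]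
      conv_lhs => rw [← zpow_one Z, ← hab, zpow_add, mul_comm b, zpow_mul Z p, zpow_natCast, hZ,
        one_zpow, mul_one]
    rw [hZ1]
    exact hstab _ _ hYu a
  rw [Finset.prod_eq_single j (fun i _ hij => h4 i hij) (by simp)] at h3
  apply htor
  simpa [Y] using h3

lemma indep_card {V : Type*} [CommGroup V] [Finite V] {p : ℕ} [hp : Fact p.Prime] (X Z : MulAut V)
    (hc : Commute X Z) (hZ : Z ^ p = 1) (hfix : ∀ v, Z v = v → v = 1)
    (htor : ∀ v : V, v ^ p = 1 → v = 1) :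
    ∏ i : Fin p, Nat.card {v // (X * Z ^ (i : ℕ)) v = v} ≤ Nat.card V := by
  rw [← Nat.card_pi]
  refine Nat.card_le_card_of_injective (fun v => ∏ i, (v i).1) ?_
  intro v v' h
  funext i
  apply Subtype.ext
  have := indep_aux X Z hc hZ hfix htor (fun i => (v i).1 / (v' i).1)
    (fun i : Fin p => by rw [map_div, (v i).2, (v' i).2]) (by
      rw [Finset.prod_div_distrib]; exact div_eq_one.2 h) i
  exact div_eq_one.1 this

lemma abelian_case {p : ℕ} [hp : Fact p.Prime] {G : Type*} [Group G] [Finite G] (P : Sylow p G)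
    (M : Subgroup G) [M.Normal] (hcomm : ∀ a b : M, a * b = b * a)
    (htor : ∀ m : M, m ^ p = 1 → m = 1) (hMP : M ⊔ (P : Subgroup G) = ⊤)
    (z : G) (hz : z ∈ P) (hzp : z ^ p = 1) (hzc : ∀ x ∈ P, x * z = z * x)
    (hfix : ∀ m ∈ M, z * m * z⁻¹ = m → m = 1) :
    (∏ᶠ x ∈ ((P : Subgroup G) : Set G), sylCount p x) ^ p ≤
      Nat.card (Sylow p G) ^ Nat.card (P : Subgroup G) := by
  classical
  have := Fintype.ofFinite (P : Subgroup G)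
  let _ : CommGroup M := { (inferInstance : Group M) with mul_comm := hcomm }
  have hint : ∀ g, g ∈ P → g ∈ M → g = 1 := by
    intro g hgP hgM
    obtain ⟨k, hk⟩ := P.isPGroup' ⟨g, hgP⟩
    have hk : g ^ p ^ k = 1 := congrArg Subtype.val hk
    have : ∀ (k : ℕ) (m : M), m ^ p ^ k = 1 → m = 1 := by
      intro k
      induction k with
      | zero => intro m h; simpa using h
      | succ k ih => intro m h; rw [pow_succ, pow_mul] at h; exact ih m (htor _ h)
    exact congrArg Subtype.val (this k ⟨g, hgM⟩ (Subtype.ext hk))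
  let c : G → ℕ := fun x => Nat.card {m : M // MulAut.conjNormal x m = m}
  have hlam : ∀ x ∈ P, sylCount p x ≤ c x := by
    intro x hx
    let f : {m : M // MulAut.conjNormal x m = m} → {Q : Sylow p G // x ∈ Q} := fun m =>
      ⟨(m.1 : G) • P, by
        rw [mem_smul_syl]
        have h : x * m.1 * x⁻¹ = (m.1 : G) := congrArg Subtype.val m.2
        have h' : ((m.1 : G))⁻¹ * x * m.1 = x := by
          rw [mul_inv_eq_iff_eq_mul] at h
          rw [mul_assoc, h]; simp
        rw [h']; exact hx⟩
    refine Nat.card_le_card_of_surjective f ?_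
    rintro ⟨Q, hQ⟩
    obtain ⟨g, rfl⟩ := MulAction.exists_smul_eq G P Q
    have hg : g ∈ M ⊔ (P : Subgroup G) := by rw [hMP]; trivial
    obtain ⟨m, hm, q, hq, rfl⟩ := Subgroup.mem_sup_of_normal_left.1 hg
    have e : (m * q) • P = m • P := by
      rw [mul_smul]
      congr 1
      rw [Sylow.smul_eq_iff_mem_normalizer]
      exact Subgroup.le_normalizer hq
    rw [e, mem_smul_syl] at hQ
    have h1 : m⁻¹ * x * m * x⁻¹ = 1 := by
      refine hint _ (mul_mem hQ (inv_mem hx)) ?_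
      have := ‹M.Normal›.conj_mem m hm x
      have h := mul_mem (inv_mem hm) this
      simpa [mul_assoc] using h
    refine ⟨⟨⟨m, hm⟩, Subtype.ext ?_⟩, Subtype.ext e.symm⟩
    change x * m * x⁻¹ = m
    have : m⁻¹ * (x * m * x⁻¹) = 1 := by rw [← h1]; group
    exact (inv_mul_eq_one.1 this).symm
  have hn : Nat.card M ≤ Nat.card (Sylow p G) := by
    refine Nat.card_le_card_of_injective (fun m : M => (m : G) • P) ?_
    intro m m' h
    have h' : ((m : G)⁻¹ * m') • P = P := by
      rw [mul_smul, inv_smul_eq_iff]; exact h.symm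
    set n : G := (m : G)⁻¹ * m' with hn
    have hnM : n ∈ M := mul_mem (inv_mem m.2) m'.2
    have h1 : z ∈ n • P := by rw [h']; exact hz
    rw [mem_smul_syl] at h1
    have h2 : n⁻¹ * z * n * z⁻¹ = 1 := by
      refine hint _ (mul_mem h1 (inv_mem hz)) ?_
      have := ‹M.Normal›.conj_mem n hnM z
      have h := mul_mem (inv_mem hnM) this
      simpa [mul_assoc] using h
    have h3 : n = 1 := by
      refine hfix n hnM ?_
      have : n⁻¹ * (z * n * z⁻¹) = 1 := by rw [← h2]; group
      exact (inv_mul_eq_one.1 this).symm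
    exact Subtype.ext (inv_mul_eq_one.1 h3)
  rw [finprod_conv]
  calc (∏ x : (P : Subgroup G), sylCount p (x : G)) ^ p
      ≤ (∏ x : (P : Subgroup G), c (x : G)) ^ p :=
        Nat.pow_le_pow_left (Finset.prod_le_prod' fun (x : (P : Subgroup G)) _ => hlam x x.2) p
    _ = ∏ i : Fin p, ∏ x : (P : Subgroup G), c ((x : G) * z ^ (i : ℕ)) := by
        rw [Finset.prod_congr rfl (g := fun _ : Fin p => ∏ x : (P : Subgroup G), c x)]
        · simp
        · intro i _
          exact Fintype.prod_equiv (Equiv.mulRight ((⟨z, hz⟩ : (P : Subgroup G)) ^ (i : ℕ))) _ _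
            (fun x => rfl)
    _ = ∏ x : (P : Subgroup G), ∏ i : Fin p, c ((x : G) * z ^ (i : ℕ)) := Finset.prod_comm
    _ ≤ ∏ x : (P : Subgroup G), Nat.card M := by
        refine Finset.prod_le_prod' fun x _ => ?_
        have := indep_card (V := M) (p := p) (MulAut.conjNormal (x : G)) (MulAut.conjNormal z)
          (by
            have h : Commute (x : G) z := hzc x x.2
            exact h.map MulAut.conjNormal) (by rw [← map_pow, hzp, map_one])
          (fun v hv => Subtype.ext (hfix v v.2 (congrArg Subtype.val hv))) htor
        simpa only [c, map_mul, map_pow] using this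
    _ = Nat.card M ^ Nat.card (P : Subgroup G) := by simp
    _ ≤ _ := Nat.pow_le_pow_left hn _

/-- A minimal counterexample `G` (with Sylow `p`-subgroup `P`) to the inequality
`(∏_{x ∈ P} λ_G(x))^p ≤ n_p(G)^{|P|}` is nonsolvable, has a unique minimal normal
subgroup `M`, which is nonsolvable, and satisfies `G = MP`. -/
theorem minimal_counterexample_structure {p : ℕ} (hp : p.Prime)
    (G : Type) [Group G] [Fintype G] (P : Sylow p G)
    (hbad : Nat.card (Sylow p G) ^ Nat.card (P : Subgroup G) <
      (∏ᶠ x ∈ ((P : Subgroup G) : Set G), sylCount p x) ^ p)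
    (hmin : ∀ (G' : Type) [Group G'] [Fintype G'], Nat.card G' < Nat.card G →
      ∀ Q : Sylow p G',
        (∏ᶠ x ∈ ((Q : Subgroup G') : Set G'), sylCount p x) ^ p ≤
          Nat.card (Sylow p G') ^ Nat.card (Q : Subgroup G')) :
    ¬ IsSolvable G ∧
      ∃ M : Subgroup G, M.Normal ∧ M ≠ ⊥ ∧
        (∀ K : Subgroup G, K.Normal → K ≠ ⊥ → K ≤ M → K = M) ∧
        (∀ M' : Subgroup G, M'.Normal → M' ≠ ⊥ →
          (∀ K : Subgroup G, K.Normal → K ≠ ⊥ → K ≤ M' → K = M') → M' = M) ∧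
        ¬ IsSolvable M ∧
        M ⊔ (P : Subgroup G) = ⊤ := by
  classical
  have : Fact p.Prime := ⟨hp⟩
  have hPn : ¬ (P : Subgroup G).Normal := by
    intro hN
    have := P.unique_of_normal hN
    have hs : ∀ x : G, sylCount p x ≤ 1 := by
      intro x
      unfold sylCount
      rw [← Nat.card_unique (α := Sylow p G)]
      exact Nat.card_le_card_of_injective Subtype.val Subtype.val_injective
    rw [finprod_conv, Nat.card_unique, one_pow] at hbad
    have h1 : ∏ x : (P : Subgroup G), sylCount p (x : G) ≤ 1 :=
      Finset.prod_le_one' fun x _ => hs x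
    exact absurd hbad (not_lt.2 (pow_le_one' h1 p))
  have hPtop : (P : Subgroup G) ≠ ⊤ := fun h => hPn (by rw [h]; infer_instance)
  have star : ∀ N : Subgroup G, N.Normal → N ≠ ⊥ → N ⊔ (P : Subgroup G) = ⊤ := by
    intro N hN hb
    by_contra htop
    refine absurd hbad (not_lt.2 (ineq_reduce N P ?_ ?_))
    · have := Fintype.ofFinite (G ⧸ N)
      apply hmin
      rw [Subgroup.card_eq_card_quotient_mul_card_subgroup N]
      have h1 : 1 < Nat.card N := (Subgroup.one_lt_card_iff_ne_bot N).2 hb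
      exact lt_mul_of_one_lt_right Nat.card_pos h1
    · have := Fintype.ofFinite (Kpre N (PhiS N P))
      apply hmin
      have hK : Kpre N (PhiS N P) ≠ ⊤ := by
        intro hK
        apply htop
        rw [eq_top_iff, ← hK]
        rintro k ⟨q, hq, hqk⟩
        have h : q⁻¹ * k ∈ N := QuotientGroup.eq.1 hqk
        have h2 : q * (q⁻¹ * k) ∈ N ⊔ (P : Subgroup G) :=
          mul_mem (Subgroup.mem_sup_right hq) (Subgroup.mem_sup_left h)
        simpa using h2
      refine lt_of_le_of_ne (Subgroup.card_le_card_group _) ?_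
      exact fun h => hK (Subgroup.eq_top_of_card_eq _ h)
  have pn : ∀ N : Subgroup G, N.Normal → IsPGroup p N → N = ⊥ := by
    intro N hN hp
    by_contra hb
    have h := star N hN hb
    rw [sup_eq_right.2 (hp.le_sylow_of_normal P)] at h
    exact hPtop h
  have pgq : ∀ N : Subgroup G, N.Normal → N ≠ ⊥ → ∀ g : G, ∃ k : ℕ, g ^ p ^ k ∈ N := by
    intro N hN hb g
    have hg : g ∈ N ⊔ (P : Subgroup G) := by rw [star N hN hb]; trivial
    obtain ⟨m, hm, q, hq, rfl⟩ := Subgroup.mem_sup_of_normal_left.1 hg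
    obtain ⟨k, hk⟩ := P.isPGroup' ⟨q, hq⟩
    have hk : q ^ p ^ k = 1 := congrArg Subtype.val hk
    refine ⟨k, ?_⟩
    rw [← QuotientGroup.eq_one_iff, QuotientGroup.mk_pow, QuotientGroup.mk_mul,
      (QuotientGroup.eq_one_iff m).2 hm, one_mul, ← QuotientGroup.mk_pow, hk, QuotientGroup.mk_one]
  have hex : ∃ M : Subgroup G, (M.Normal ∧ M ≠ ⊥) ∧
      ∀ K : Subgroup G, K.Normal → K ≠ ⊥ → K ≤ M → K = M := by
    have hne : {N : Subgroup G | N.Normal ∧ N ≠ ⊥}.Nonempty := by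
      refine ⟨⊤, inferInstance, fun h => hPtop ?_⟩
      rw [h, eq_bot_iff, ← h]
      exact le_top
    obtain ⟨M, hM, hmin⟩ := (wellFounded_lt (α := Subgroup G)).has_min _ hne
    refine ⟨M, hM, fun K hK hKb hKM => ?_⟩
    by_contra hne
    exact hmin K ⟨hK, hKb⟩ (lt_of_le_of_ne hKM hne)
  obtain ⟨M, ⟨hMn, hMb⟩, hMmin⟩ := hex
  have hMP := star M hMn hMb
  have hMsol : ¬ IsSolvable M := by
    intro hsol0
    have hsol : Group.IsSolvable M := hsol0
    have hcomm : ∀ a b : M, a * b = b * a := by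
      have hlt : ⁅M, M⁆ = ⊥ := by
        by_contra hb
        have h := hMmin ⁅M, M⁆ inferInstance hb (Subgroup.commutator_le_left M M)
        have : Nontrivial M := (Subgroup.nontrivial_iff_ne_bot M).2 hMb
        have h2   := Group.IsSolvable.commutator_lt_top_of_nontrivial M
        apply h2.ne
        apply Subgroup.map_injective M.subtype_injective
        rw [Subgroup.map_subtype_commutator, h, ← MonoidHom.range_eq_map, Subgroup.range_subtype]
      rw [Subgroup.commutator_eq_bot_iff_le_centralizer] at hlt
      intro a b
      exact Subtype.ext (Subgroup.mem_centralizer_iff.1 (hlt b.2) a a.2)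
    have hcomm' : ∀ a ∈ M, ∀ b ∈ M, a * b = b * a := fun a ha b hb =>
      congrArg Subtype.val (hcomm ⟨a, ha⟩ ⟨b, hb⟩)
    have htor : ∀ m : M, m ^ p = 1 → m = 1 := by
      let T : Subgroup G :=
        { carrier := {g | g ∈ M ∧ g ^ p = 1}
          mul_mem' := by
            rintro a b ⟨ha, ha'⟩ ⟨hb, hb'⟩
            refine ⟨mul_mem ha hb, ?_⟩
            have : Commute a b := hcomm' a ha b hb
            rw [this.mul_pow, ha', hb', one_mul]
          one_mem' := ⟨one_mem _, one_pow _⟩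
          inv_mem' := by
            rintro a ⟨ha, ha'⟩
            exact ⟨inv_mem ha, by rw [inv_pow, ha', inv_one]⟩ }
      have hTn : T.Normal := ⟨by
        rintro n ⟨hn, hn'⟩ g
        exact ⟨hMn.conj_mem n hn g, by rw [conj_pow, hn']; simp⟩⟩
      have hTp : IsPGroup p T := by
        rintro ⟨g, hg, hg'⟩
        exact ⟨1, Subtype.ext (by simpa using hg')⟩
      have hT := pn T hTn hTp
      intro m hm
      have : (m : G) ∈ T := ⟨m.2, congrArg Subtype.val hm⟩
      rw [hT, Subgroup.mem_bot] at this
      exact Subtype.ext this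
    have hPb : (P : Subgroup G) ≠ ⊥ := fun h => hPn (by rw [h]; infer_instance)
    obtain ⟨z, hzP, hzp, hz1, hzc⟩ : ∃ z : G, z ∈ P ∧ z ^ p = 1 ∧ z ≠ 1 ∧
        ∀ x ∈ P, x * z = z * x := by
      have : Nontrivial (P : Subgroup G) := (Subgroup.nontrivial_iff_ne_bot _).2 hPb
      have hc := P.isPGroup'.center_nontrivial
      have hcp : IsPGroup p (Subgroup.center (P : Subgroup G)) := P.isPGroup'.to_subgroup _
      obtain ⟨n, hn, hcard⟩ := hcp.nontrivial_iff_card.1 hc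
      obtain ⟨z, hz⟩ := exists_prime_orderOf_dvd_card' (G := Subgroup.center (P : Subgroup G)) p
        (by rw [hcard]; exact dvd_pow_self p hn.ne')
      refine ⟨z.1.1, z.1.2, ?_, ?_, ?_⟩
      · have h : z ^ p = 1 := orderOf_dvd_iff_pow_eq_one.1 hz.dvd
        exact congrArg (fun t => t.1.1) h
      · intro h
        have : z = 1 := Subtype.ext (Subtype.ext h)
        rw [this, orderOf_one] at hz
        exact hp.one_lt.ne hz
      · intro x hx
        exact congrArg Subtype.val (Subgroup.mem_center_iff.1 z.2 ⟨x, hx⟩)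
    have hdec : ∀ g : G, ∃ a ∈ M, ∃ q ∈ P, a * q = g := by
      intro g
      have hg : g ∈ M ⊔ (P : Subgroup G) := by rw [hMP]; trivial
      exact Subgroup.mem_sup_of_normal_left.1 hg
    have hfix : ∀ m ∈ M, z * m * z⁻¹ = m → m = 1 := by
      let C : Subgroup G := M ⊓ Subgroup.centralizer {z}
      have hC : ∀ m, m ∈ C ↔ m ∈ M ∧ z * m = m * z := by
        intro m
        simp only [C, Subgroup.mem_inf, Subgroup.mem_centralizer_singleton_iff]
        exact and_congr_right fun _ => eq_comm
      have hCn : C.Normal := ⟨by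
        intro n hn g
        rw [hC] at hn ⊢
        obtain ⟨hn, hnz⟩ := hn
        obtain ⟨a, ha, q, hq, rfl⟩ := hdec g
        refine ⟨hMn.conj_mem n hn _, ?_⟩
        have h1 : a * q * n * (a * q)⁻¹ = q * n * q⁻¹ := by
          have := hcomm' a ha _ (hMn.conj_mem n hn q)
          calc a * q * n * (a * q)⁻¹ = a * (q * n * q⁻¹) * a⁻¹ := by group
            _ = _ := by rw [this]; group
        rw [h1]
        have c1 : Commute z q := (hzc q hq).symm
        have c2 : Commute z n := hnz
        exact (c1.mul_right c2).mul_right c1.inv_right⟩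
      have hCb : C = ⊥ := by
        by_contra hb
        have hCM := hMmin C hCn hb inf_le_left
        have hzcen : ∀ g : G, g * z = z * g := by
          intro g
          obtain ⟨a, ha, q, hq, rfl⟩ := hdec g
          rw [← hCM] at ha
          have c1 : Commute z a := ((hC a).1 ha).2
          have c2 : Commute z q := (hzc q hq).symm
          exact (c1.mul_right c2).symm
        have hzn : (Subgroup.zpowers z).Normal := ⟨by
          intro n hn g
          obtain ⟨k, rfl⟩ := Subgroup.mem_zpowers_iff.1 hn
          have : Commute g (z ^ k) := (show Commute g z from hzcen g).zpow_right k
          rw [this.eq, mul_inv_cancel_right]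
          exact hn⟩
        have := pn _ hzn (P.isPGroup'.to_le ((Subgroup.zpowers_le).2 hzP))
        exact hz1 (Subgroup.zpowers_eq_bot.1 this)
      intro m hm h
      have : m ∈ C := (hC m).2 ⟨hm, mul_inv_eq_iff_eq_mul.1 h⟩
      rw [hCb] at this
      exact Subgroup.mem_bot.1 this
    exact absurd hbad (not_lt.2 (abelian_case P M hcomm htor hMP z hzP hzp hzc hfix))
  have hGsol : ¬ IsSolvable G := by
    intro h0
    have h : Group.IsSolvable G := h0
    have h2 : Group.IsSolvable M := inferInstance
    exact hMsol h2
  refine ⟨hGsol, M, hMn, hMb, hMmin, ?_, hMsol, hMP⟩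
  intro M' hn' hb' hmin'
  by_contra hne
  have hinf : M ⊓ M' = ⊥ := by
    by_contra hb
    have h1 := hMmin (M ⊓ M') inferInstance hb inf_le_left
    have h2 := hmin' (M ⊓ M') inferInstance hb inf_le_right
    exact hne (h2.symm.trans h1)
  have hG : IsPGroup p (⊤ : Subgroup G) := by
    rintro ⟨g, hg⟩
    obtain ⟨k, hk⟩ := pgq M hMn hMb g
    obtain ⟨l, hl⟩ := pgq M' hn' hb' g
    refine ⟨k + l, Subtype.ext ?_⟩
    change g ^ p ^ (k + l) = 1
    rw [← Subgroup.mem_bot, ← hinf]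
    constructor
    · rw [pow_add, pow_mul]
      exact pow_mem hk _
    · rw [pow_add, mul_comm, pow_mul]
      exact pow_mem hl _
  exact hPtop (top_le_iff.1 (hG.le_sylow_of_normal P))
end

section
/- Let G be a finite group, p a prime, N a normal subgroup of G, and x ∈ N a p-element. Then |S_G(x)| · |N| = |S_N(x)| · |G|. -/
open Subgroup

/-- `H` is subnormal in `K` (as subgroups of an ambient group `G`): there is a chain
`H = H₀ ⊴ H₁ ⊴ ⋯ ⊴ Hₙ = K` with each term normal in the next. -/
def IsSubnormalIn {G : Type*} [Group G] (H K : Subgroup G) : Prop :=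
  ∃ (n : ℕ) (c : Fin (n + 1) → Subgroup G), c 0 = H ∧ c (Fin.last n) = K ∧
    ∀ i : Fin n, c i.castSucc ≤ c i.succ ∧ ((c i.castSucc).subgroupOf (c i.succ)).Normal

/-- The subnormalizer `S_G(x)`: the set of `g ∈ G` with `⟨x⟩` subnormal in `⟨x, g⟩`. -/
def subnormalizerSet {G : Type*} [Group G] (x : G) : Set G :=
  {g : G | IsSubnormalIn (zpowers x) (zpowers x ⊔ zpowers g)}

/-- `S_N(x)` for a subgroup `N`: the set of `g ∈ N` with `⟨x⟩` subnormal in `⟨x, g⟩`. -/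
def subnormalizerSetIn {G : Type*} [Group G] (N : Subgroup G) (x : G) : Set G :=
  {g : G | g ∈ N ∧ IsSubnormalIn (zpowers x) (zpowers x ⊔ zpowers g)}


open scoped Pointwise

section Poset

/-- Recursively defined weights on a finite poset: `ee A X = 1 - ∑_{Y ∈ A, X < Y} ee A Y`. -/
noncomputable def ee {α : Type*} [PartialOrder α] [Finite α] (A : Finset α) : α → ℤ :=
  open Classical in
  WellFounded.fix (r := fun a b : α => b < a) (wellFounded_gt (α := α))
    (fun X rec => 1 - ∑ Y ∈ A, if h : X < Y then rec Y h else 0)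

open Classical in
theorem ee_eq {α : Type*} [PartialOrder α] [Finite α] (A : Finset α) (X : α) :
    ee A X = 1 - ∑ Y ∈ A with X < Y, ee A Y := by
  conv_lhs => unfold ee
  rw [WellFounded.fix_eq]
  rw [Finset.sum_filter]
  rfl

open Classical in
theorem ee_sum {α : Type*} [PartialOrder α] [Finite α] (A : Finset α) (X : α) (hX : X ∈ A) :
    ∑ Y ∈ A with X ≤ Y, ee A Y = 1 := by
  have h : (A.filter (fun Y => X ≤ Y)) = insert X (A.filter (fun Y => X < Y)) := by
    ext Y
    simp only [Finset.mem_filter, Finset.mem_insert, le_iff_eq_or_lt]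
    constructor
    · rintro ⟨h1, rfl | h2⟩
      · exact Or.inl rfl
      · exact Or.inr ⟨h1, h2⟩
    · rintro (rfl | ⟨h1, h2⟩)
      · exact ⟨hX, Or.inl rfl⟩
      · exact ⟨h1, Or.inr h2⟩
  rw [h, Finset.sum_insert (by simp), ee_eq A X]
  ring

open Classical in
theorem ee_transfer {α : Type*} [PartialOrder α] [Finite α] (A B : Finset α) (hBA : B ⊆ A)
    (q : α) (ρ : α → α) (h1 : ∀ R ∈ A, q < R → ρ R ∈ B ∧ q < ρ R)
    (h2 : ∀ X ∈ B, ∀ R ∈ A, X ≤ ρ R ↔ X ≤ R) : ee A q = ee B q := by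
  have key : ∀ Y : α, Y ∈ B → q < Y → ∑ R ∈ A with q < R ∧ ρ R = Y, ee A R = ee B Y := by
    intro Y
    induction Y using WellFoundedGT.induction with
    | ind Y ih =>
      intro hY hq
      have e1 := ee_sum A Y (hBA hY)
      have e2 : ∑ R ∈ A with Y ≤ R, ee A R
          = ∑ Y' ∈ B with Y ≤ Y', ∑ R ∈ A with q < R ∧ ρ R = Y', ee A R := by
        rw [← Finset.sum_fiberwise_of_maps_to (s := A.filter (fun R => Y ≤ R))
          (t := B.filter (fun Y' => Y ≤ Y')) (g := ρ)]
        · apply Finset.sum_congr rfl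
          intro Y' hY'
          rw [Finset.mem_filter] at hY'
          apply Finset.sum_congr _ (fun _ _ => rfl)
          ext R
          simp only [Finset.mem_filter]
          constructor
          · rintro ⟨⟨a, b⟩, c⟩
            exact ⟨a, hq.trans_le b, c⟩
          · rintro ⟨a, b, rfl⟩
            exact ⟨⟨a, (h2 Y hY R a).1 hY'.2⟩, rfl⟩
        · intro R hR
          rw [Finset.mem_filter] at hR ⊢
          exact ⟨(h1 R hR.1 (hq.trans_le hR.2)).1, (h2 Y hY R hR.1).2 hR.2⟩
      have hins : (B.filter (fun Z => Y ≤ Z)) = insert Y (B.filter (fun Z => Y < Z)) := by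
        ext Z
        simp only [Finset.mem_filter, Finset.mem_insert, le_iff_eq_or_lt]
        constructor
        · rintro ⟨h1, rfl | h2⟩
          · exact Or.inl rfl
          · exact Or.inr ⟨h1, h2⟩
        · rintro (rfl | ⟨h1, h2⟩)
          · exact ⟨hY, Or.inl rfl⟩
          · exact ⟨h1, Or.inr h2⟩
      rw [e1, hins, Finset.sum_insert (by simp)] at e2
      have e3 : ∑ Y' ∈ B with Y < Y', ∑ R ∈ A with q < R ∧ ρ R = Y', ee A R
          = ∑ Y' ∈ B with Y < Y', ee B Y' := by
        apply Finset.sum_congr rfl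
        intro Z hZ
        rw [Finset.mem_filter] at hZ
        exact ih Z hZ.2 hZ.1 (hq.trans hZ.2)
      rw [ee_eq B Y]
      linarith
  rw [ee_eq A q, ee_eq B q]
  congr 1
  rw [← Finset.sum_fiberwise_of_maps_to (s := A.filter (fun R => q < R))
          (t := B.filter (fun Y' => q < Y')) (g := ρ)]
  · apply Finset.sum_congr rfl
    intro Y hY
    rw [Finset.mem_filter] at hY
    rw [← key Y hY.1 hY.2, Finset.filter_filter]
  · intro R hR
    rw [Finset.mem_filter] at hR ⊢
    exact h1 R hR.1 hR.2

end Poset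

section Max

variable {G : Type*} [Group G]

/-- `P` is a maximal `p`-subgroup of `H`. -/
def IsMx (p : ℕ) (H P : Subgroup G) : Prop :=
  P ≤ H ∧ IsPGroup p P ∧ ∀ R : Subgroup G, R ≤ H → IsPGroup p R → P ≤ R → R = P

/-- Conjugate subgroup. -/
def cj (g : G) (R : Subgroup G) : Subgroup G := R.map (MulAut.conj g).toMonoidHom

theorem mem_cj {g y : G} {R : Subgroup G} : y ∈ cj g R ↔ g⁻¹ * y * g ∈ R := by
  unfold cj
  rw [Subgroup.mem_map]
  constructor
  · rintro ⟨z, hz, rfl⟩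
    simpa [mul_assoc] using hz
  · intro h
    exact ⟨_, h, by simp [mul_assoc]⟩

theorem cj_cj (g h : G) (R : Subgroup G) : cj g (cj h R) = cj (g * h) R := by
  ext y
  simp [mem_cj, mul_assoc]

theorem cj_one (R : Subgroup G) : cj 1 R = R := by
  ext y
  simp [mem_cj]

theorem cj_inj (g : G) : Function.Injective (cj g : Subgroup G → Subgroup G) := by
  intro A B h
  have := congrArg (cj g⁻¹) h
  simpa [cj_cj, cj_one] using this

theorem cj_mono {g : G} {A B : Subgroup G} (h : A ≤ B) : cj g A ≤ cj g B := by
  intro y hy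
  rw [mem_cj] at hy ⊢
  exact h hy

theorem cj_inf (g : G) (A B : Subgroup G) : cj g (A ⊓ B) = cj g A ⊓ cj g B := by
  ext y
  simp [mem_cj, Subgroup.mem_inf]

theorem mem_norm_iff {g : G} {R : Subgroup G} : g ∈ normalizer (R : Set G) ↔ cj g R = R := by
  rw [mem_normalizer_iff_map_conj_eq]
  rfl

theorem cj_eq_of_mem {g : G} {H : Subgroup G} (h : g ∈ H) : cj g H = H :=
  mem_norm_iff.1 (le_normalizer h)

theorem IsPGroup.cj' {p : ℕ} {R : Subgroup G} (h : IsPGroup p R) (g : G) :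
    IsPGroup p (cj g R) := h.map _

theorem card_cj [Finite G] (g : G) (R : Subgroup G) : Nat.card (cj g R) = Nat.card R :=
  Nat.card_congr (R.equivMapOfInjective _ (MulAut.conj g).injective).toEquiv.symm

theorem IsMx.cj' {p : ℕ} {H P : Subgroup G} (h : IsMx p H P) {g : G} (hg : cj g H = H) :
    IsMx p H (cj g P) := by
  have hg' : cj g⁻¹ H = H := by
    conv_lhs => rw [← hg]
    simp [cj_cj, cj_one]
  refine ⟨hg ▸ cj_mono h.1, h.2.1.cj' g, ?_⟩
  intro R hR hp hle
  have := h.2.2 (cj g⁻¹ R) (hg' ▸ cj_mono hR) (hp.cj' _)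
    (by have := cj_mono (g := g⁻¹) hle; simpa [cj_cj, cj_one] using this)
  rw [← this]; simp [cj_cj, cj_one]

/-- Maximal `p`-subgroups of `H` are the Sylow subgroups of `H`. -/
def mxEquiv (p : ℕ) (H : Subgroup G) : Sylow p H ≃ {P : Subgroup G // IsMx p H P} where
  toFun P := ⟨P.1.map H.subtype, map_subtype_le _, P.2.map _, by
    intro R hR hp hle
    have := P.3 (Q := R.subgroupOf H) hp.comap_subtype (map_le_iff_le_comap.1 hle)
    rw [← this, map_subgroupOf_eq_of_le hR]⟩
  invFun P := ⟨P.1.subgroupOf H, P.2.2.1.comap_subtype, by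
    intro Q hQ hle
    have := P.2.2.2 (Q.map H.subtype) (map_subtype_le _) (hQ.map _)
      (by
        have := Subgroup.map_mono (f := H.subtype) hle
        rwa [map_subgroupOf_eq_of_le P.2.1] at this)
    rw [← this]
    exact (comap_map_eq_self_of_injective H.subtype_injective Q).symm⟩
  left_inv P := by
    ext1
    exact comap_map_eq_self_of_injective H.subtype_injective P.1
  right_inv P := by
    ext1
    exact map_subgroupOf_eq_of_le P.2.1

theorem exists_mx {p : ℕ} {H R : Subgroup G} (hR : R ≤ H) (hp : IsPGroup p R) :
    ∃ P, IsMx p H P ∧ R ≤ P := by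
  obtain ⟨Q, hQ⟩ := IsPGroup.exists_le_sylow (P := R.subgroupOf H) hp.comap_subtype
  refine ⟨_, (mxEquiv p H Q).2, ?_⟩
  have := Subgroup.map_mono (f := H.subtype) hQ
  rwa [map_subgroupOf_eq_of_le hR] at this

theorem mx_conj [Finite G] {p : ℕ} [Fact p.Prime] {H P Q : Subgroup G} (hP : IsMx p H P)
    (hQ : IsMx p H Q) : ∃ h ∈ H, cj h P = Q := by
  obtain ⟨h, hh⟩ := MulAction.exists_smul_eq H ((mxEquiv p H).symm ⟨P, hP⟩)
    ((mxEquiv p H).symm ⟨Q, hQ⟩)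
  refine ⟨h, h.2, ?_⟩
  have h2 : MulAut.conj h • P.subgroupOf H = Q.subgroupOf H :=
    congrArg Sylow.toSubgroup hh
  rw [← map_subgroupOf_eq_of_le hQ.1, ← h2]
  conv_lhs => rw [← map_subgroupOf_eq_of_le hP.1]
  ext y
  rw [mem_cj]
  simp only [Subgroup.mem_map, Subgroup.mem_pointwise_smul_iff_inv_smul_mem]
  constructor
  · rintro ⟨z, hz, hz2⟩
    refine ⟨h * z * h⁻¹, ?_, ?_⟩
    · simpa [mul_assoc] using hz
    · simp only [subtype_apply] at hz2
      simp [hz2, mul_assoc]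
  · rintro ⟨z, hz, rfl⟩
    exact ⟨_, hz, by simp⟩

theorem mx_card_norm [Finite G] {p : ℕ} [Fact p.Prime] {H P : Subgroup G} (hP : IsMx p H P) :
    Nat.card {P : Subgroup G // IsMx p H P} * Nat.card (H ⊓ normalizer (P : Set G) : Subgroup G)
      = Nat.card H := by
  have h1 := ((mxEquiv p H).symm ⟨P, hP⟩).card_eq_index_normalizer
  rw [Nat.card_congr (mxEquiv p H)] at h1
  rw [h1]
  have h2 : normalizer (((mxEquiv p H).symm ⟨P, hP⟩ : Sylow p H) : Set H)
      = (normalizer (P : Set G)).subgroupOf H := by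
    ext y
    rw [Subgroup.mem_subgroupOf]
    change y ∈ normalizer ((P.subgroupOf H : Subgroup H) : Set H) ↔ _
    rw [mem_normalizer_iff, mem_normalizer_iff]
    constructor
    · intro h z
      by_cases hz : z ∈ H
      · exact h ⟨z, hz⟩
      · constructor
        · intro h'; exact absurd (hP.1 h') hz
        · intro h'
          refine absurd ?_ hz
          have := hP.1 h'
          rwa [H.mul_mem_cancel_right (H.inv_mem y.2), H.mul_mem_cancel_left y.2] at this
    · intro h z
      exact h z
  rw [h2, mul_comm]
  have h3 := Subgroup.card_mul_index ((normalizer (P : Set G)).subgroupOf H)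
  rw [← h3]
  congr 1
  have h4 : (H ⊓ normalizer (P : Set G)) = ((normalizer (P : Set G)).subgroupOf H).map H.subtype := by
    rw [subgroupOf_map_subtype, inf_comm]
  rw [h4]
  exact Subgroup.card_map_of_injective H.subtype_injective

theorem norm_grow [Finite G] {p : ℕ} [Fact p.Prime] {Q R : Subgroup G} (hR : IsPGroup p R)
    (h : Q < R) : Q < R ⊓ normalizer (Q : Set G) := by
  have : Group.IsNilpotent R := hR.isNilpotent
  have hc : NormalizerCondition R := Group.normalizerCondition_of_isNilpotent
  have hlt : Q.subgroupOf R < ⊤ := by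
    rw [lt_top_iff_ne_top, Ne, subgroupOf_eq_top]
    exact fun h' => absurd h (not_lt_of_ge h')
  obtain ⟨z, hz1, hz2⟩ := SetLike.exists_of_lt (hc _ hlt)
  refine lt_of_le_of_ne (le_inf h.le le_normalizer) ?_
  intro heq
  apply hz2
  rw [mem_subgroupOf, heq]
  refine ⟨z.2, ?_⟩
  rw [mem_normalizer_iff] at hz1
  change (z : G) ∈ normalizer (Q : Set G)
  rw [mem_normalizer_iff]
  intro y
  by_cases hy : y ∈ R
  · exact hz1 ⟨y, hy⟩
  · constructor
    · intro h'; exact absurd (h.le h') hy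
    · intro h'
      refine absurd ?_ hy
      have := h.le h'
      rwa [R.mul_mem_cancel_right (R.inv_mem z.2), R.mul_mem_cancel_left z.2] at this

theorem mx_inf_normal [Finite G] {p : ℕ} [Fact p.Prime] {K M P : Subgroup G} (hMK : M ≤ K)
    (hn : K ≤ normalizer (M : Set G)) (hP : IsMx p K P) : IsMx p M (P ⊓ M) := by
  obtain ⟨T, hT, hTle⟩ := exists_mx (p := p) (H := M) (R := P ⊓ M) inf_le_right
    hP.2.1.to_inf_left
  obtain ⟨P', hP', hTP'⟩ := exists_mx (p := p) (hT.1.trans hMK) hT.2.1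
  have hT' : P' ⊓ M = T := hT.2.2 _ inf_le_right hP'.2.1.to_inf_left (le_inf hTP' hT.1)
  obtain ⟨k, hk, hkP⟩ := mx_conj hP hP'
  have hc : cj k (P ⊓ M) = T := by
    rw [cj_inf, hkP, mem_norm_iff.1 (hn hk), hT']
  have hcard : Nat.card T = Nat.card (P ⊓ M : Subgroup G) := by rw [← hc, card_cj]
  have : P ⊓ M = T := Subgroup.eq_of_le_of_card_ge hTle hcard.le
  rw [this]; exact hT

end Max

section Count

open Classical Finset

variable {G : Type*} [Group G] [Fintype G] [Fintype (Subgroup G)]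

/-- The `p`-subgroups of `H` normalized by `g`. -/
noncomputable def AA (p : ℕ) (H : Subgroup G) (g : G) : Finset (Subgroup G) :=
  univ.filter (fun R => R ≤ H ∧ IsPGroup p R ∧ g ∈ normalizer (R : Set G))

theorem mem_AA {p : ℕ} {H R : Subgroup G} {g : G} :
    R ∈ AA p H g ↔ R ≤ H ∧ IsPGroup p R ∧ g ∈ normalizer (R : Set G) := by
  simp [AA]

/-- Total weight of `R`. -/
noncomputable def ww (p : ℕ) (H R : Subgroup G) : ℤ :=
  ∑ g : G with g ∈ H ∧ g ∈ normalizer (R : Set G), ee (AA p H g) R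

theorem mem_norm_inf {g : G} {A B : Subgroup G} (hA : g ∈ normalizer (A : Set G))
    (hB : g ∈ normalizer (B : Set G)) : g ∈ normalizer ((A ⊓ B : Subgroup G) : Set G) := by
  rw [mem_norm_iff] at *
  rw [cj_inf, hA, hB]

theorem mem_norm_norm {g : G} {A : Subgroup G} (hA : g ∈ normalizer (A : Set G)) :
    g ∈ normalizer ((normalizer (A : Set G) : Subgroup G) : Set G) := le_normalizer hA

theorem card_filter_subgroup (K : Subgroup G) :
    (univ.filter (fun g => g ∈ K)).card = Nat.card K := by
  rw [Nat.card_eq_fintype_card, ← Fintype.card_subtype]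

theorem card_mx (p : ℕ) (H : Subgroup G) :
    Nat.card {P : Subgroup G // IsMx p H P} = (univ.filter (fun P => IsMx p H P)).card := by
  rw [Nat.card_eq_fintype_card, ← Fintype.card_subtype]

theorem sum_mx (p : ℕ) [Fact p.Prime] (H : Subgroup G) :
    ∑ P : Subgroup G with IsMx p H P, Nat.card (H ⊓ normalizer (P : Set G) : Subgroup G)
      = Nat.card H := by
  obtain ⟨P₀, hP₀, -⟩ := exists_mx (p := p) (H := H) (R := ⊥) bot_le IsPGroup.of_bot
  have hpos : 0 < (univ.filter (fun P => IsMx p H P)).card :=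
    Finset.card_pos.2 ⟨P₀, by simp [hP₀]⟩
  have h : ∀ P, IsMx p H P → Nat.card (H ⊓ normalizer (P : Set G) : Subgroup G)
      = Nat.card (H ⊓ normalizer (P₀ : Set G) : Subgroup G) := by
    intro P hP
    have e1 := mx_card_norm hP
    have e2 := mx_card_norm hP₀
    rw [card_mx] at e1 e2
    exact Nat.eq_of_mul_eq_mul_left hpos (e1.trans e2.symm)
  rw [Finset.sum_congr rfl (fun P hP => h P (by simpa using hP))]
  rw [Finset.sum_const, smul_eq_mul, ← card_mx]
  exact mx_card_norm hP₀

theorem ee_mx {p : ℕ} {H Q : Subgroup G} (hQ : IsMx p H Q) (g : G) : ee (AA p H g) Q = 1 := by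
  rw [ee_eq, Finset.sum_eq_zero, sub_zero]
  intro R hR
  rw [Finset.mem_filter, mem_AA] at hR
  exact absurd (hQ.2.2 R hR.1.1 hR.1.2.1 hR.2.le) hR.2.ne'

theorem ww_mx {p : ℕ} {H Q : Subgroup G} (hQ : IsMx p H Q) :
    ww p H Q = Nat.card (H ⊓ normalizer (Q : Set G) : Subgroup G) := by
  unfold ww
  rw [Finset.sum_congr rfl (fun g _ => ee_mx hQ g)]
  rw [← card_filter_subgroup]
  simp [Subgroup.mem_inf]

theorem ww_local {p : ℕ} [Fact p.Prime] {H Q : Subgroup G} (hQH : Q ≤ H) :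
    ww p H Q = ww p (H ⊓ normalizer (Q : Set G)) Q := by
  unfold ww
  have hf : univ.filter (fun g => g ∈ H ⊓ normalizer (Q : Set G) ∧ g ∈ normalizer (Q : Set G))
      = univ.filter (fun g => g ∈ H ∧ g ∈ normalizer (Q : Set G)) := by
    ext g
    simp only [Finset.mem_filter, Subgroup.mem_inf]
    tauto
  rw [hf]
  apply Finset.sum_congr rfl
  intro g hg
  rw [Finset.mem_filter] at hg
  have hgQ := hg.2.2
  apply ee_transfer _ _ _ Q (fun R => R ⊓ normalizer (Q : Set G))
  · intro R hR hlt
    rw [mem_AA] at hR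
    refine ⟨?_, norm_grow hR.2.1 hlt⟩
    rw [mem_AA]
    exact ⟨inf_le_inf_right _ hR.1, hR.2.1.to_inf_left,
      mem_norm_inf hR.2.2 (mem_norm_norm hgQ)⟩
  · intro X hX R hR
    rw [mem_AA] at hX
    exact ⟨fun h => h.trans inf_le_left, fun h => le_inf h (hX.1.trans inf_le_right)⟩
  · intro R hR
    rw [mem_AA] at hR ⊢
    exact ⟨hR.1.trans inf_le_left, hR.2⟩

theorem ww_normal {p : ℕ} {H Q : Subgroup G}
    (hn : H ≤ normalizer (Q : Set G)) :
    ww p H Q = Nat.card H - ∑ R : Subgroup G with R ≤ H ∧ IsPGroup p R ∧ Q < R, ww p H R := by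
  have h1 : ww p H Q = ∑ g : G with g ∈ H, (1 - ∑ R ∈ AA p H g with Q < R, ee (AA p H g) R) := by
    unfold ww
    have hf : univ.filter (fun g => g ∈ H ∧ g ∈ normalizer (Q : Set G))
      = univ.filter (fun g => g ∈ H) := by
      ext g
      simp only [Finset.mem_filter]
      exact ⟨fun h => ⟨h.1, h.2.1⟩, fun h => ⟨h.1, h.2, hn h.2⟩⟩
    rw [hf]
    exact Finset.sum_congr rfl (fun g _ => ee_eq _ _)
  rw [h1, Finset.sum_sub_distrib]
  congr 1
  · rw [← card_filter_subgroup]; simp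
  · unfold ww
    apply Finset.sum_comm'
    intro g R
    simp only [Finset.mem_filter, mem_AA, Finset.mem_univ, true_and]
    tauto

theorem ww_not_mx {p : ℕ} [Fact p.Prime] (n : ℕ) : ∀ H : Subgroup G, Nat.card H = n →
    ∀ Q : Subgroup G, Q ≤ H → IsPGroup p Q → ¬ IsMx p H Q → ww p H Q = 0 := by
  induction n using Nat.strong_induction_on with
  | _ n ihn =>
    intro H hH Q
    induction Q using WellFoundedGT.induction with
    | ind Q ihQ =>
      intro hQH hQp hQ
      by_cases hn : H ≤ normalizer (Q : Set G)
      · rw [ww_normal hn]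
        have hle : ∀ P, IsMx p H P → Q < P := by
          intro P hP
          have : Q ⊔ P = P := hP.2.2 _ (sup_le hQH hP.1)
            (hQp.to_sup_of_normal_left' hP.2.1 (hP.1.trans hn)) le_sup_right
          refine lt_of_le_of_ne (sup_eq_right.1 this) ?_
          rintro rfl
          exact hQ hP
        have h2 : ∑ R : Subgroup G with R ≤ H ∧ IsPGroup p R ∧ Q < R, ww p H R
            = ∑ R : Subgroup G with IsMx p H R,
              (Nat.card (H ⊓ normalizer (R : Set G) : Subgroup G) : ℤ) := by
          rw [← Finset.sum_subset (s₁ := univ.filter (fun R => IsMx p H R))]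
          · apply Finset.sum_congr rfl
            intro R hR
            rw [Finset.mem_filter] at hR
            exact ww_mx hR.2
          · intro R hR
            simp only [Finset.mem_filter, Finset.mem_univ, true_and] at hR ⊢
            exact ⟨hR.1, hR.2.1, hle R hR⟩
          · intro R hR hR'
            simp only [Finset.mem_filter, Finset.mem_univ, true_and] at hR hR'
            exact ihQ R hR.2.2 hR.1 hR.2.1 hR'
        rw [h2, ← sum_mx p H]
        push_cast
        ring
      · rw [ww_local hQH]
        have hlt : H ⊓ normalizer (Q : Set G) < H :=
          lt_of_le_of_ne inf_le_left (fun h => hn (inf_eq_left.1 h))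
        refine ihn _ ?_ _ rfl Q (le_inf hQH le_normalizer) hQp ?_
        · rw [← hH]
          exact Set.Finite.card_lt_card (Set.toFinite _) hlt
        · intro hmx
          apply hQ
          refine ⟨hQH, hQp, ?_⟩
          intro R hR hRp hle
          by_contra hne
          have hlt : Q < R := lt_of_le_of_ne hle (Ne.symm hne)
          have h3 := norm_grow hRp hlt
          exact h3.ne' (hmx.2.2 _ (inf_le_inf_right _ hR) hRp.to_inf_left h3.le)

/-- Casolo's counting formula, sum form. -/
theorem casolo_sum {p : ℕ} [Fact p.Prime] (H : Subgroup G) (x : G) (hx : x ∈ H) :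
    (univ.filter (fun g => g ∈ H ∧ ∃ R : Subgroup G, IsPGroup p R ∧ x ∈ R ∧
      g ∈ normalizer (R : Set G))).card
    = ∑ P : Subgroup G with IsMx p H P ∧ x ∈ P,
        Nat.card (H ⊓ normalizer (P : Set G) : Subgroup G) := by
  have h1 : ∑ R : Subgroup G with R ≤ H ∧ IsPGroup p R ∧ x ∈ R, ww p H R
      = ∑ P : Subgroup G with IsMx p H P ∧ x ∈ P,
        (Nat.card (H ⊓ normalizer (P : Set G) : Subgroup G) : ℤ) := by
    rw [← Finset.sum_subset (s₁ := univ.filter (fun R => IsMx p H R ∧ x ∈ R))]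
    · apply Finset.sum_congr rfl
      intro R hR
      rw [Finset.mem_filter] at hR
      exact ww_mx hR.2.1
    · intro R hR
      simp only [Finset.mem_filter, Finset.mem_univ, true_and] at hR ⊢
      exact ⟨hR.1.1, hR.1.2.1, hR.2⟩
    · intro R hR hR'
      simp only [Finset.mem_filter, Finset.mem_univ, true_and] at hR hR'
      exact ww_not_mx _ H rfl R hR.1 hR.2.1 (fun h => hR' ⟨h, hR.2.2⟩)
  have h2 : ∑ R : Subgroup G with R ≤ H ∧ IsPGroup p R ∧ x ∈ R, ww p H R
      = ∑ g : G with g ∈ H, ∑ R ∈ AA p H g with x ∈ R, ee (AA p H g) R := by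
    unfold ww
    apply Finset.sum_comm'
    intro R g
    simp only [Finset.mem_filter, mem_AA, Finset.mem_univ, true_and]
    tauto
  have h3 : ∀ g ∈ H, ∑ R ∈ AA p H g with x ∈ R, ee (AA p H g) R
      = if ∃ R : Subgroup G, IsPGroup p R ∧ x ∈ R ∧ g ∈ normalizer (R : Set G) then 1 else 0 := by
    intro g hg
    split_ifs with hex
    · obtain ⟨R, hRp, hxR, hgR⟩ := hex
      set R₀ : Subgroup G := sInf {R | R ∈ AA p H g ∧ x ∈ R} with hR₀
      have hR1 : R ⊓ H ∈ AA p H g := by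
        rw [mem_AA]
        exact ⟨inf_le_right, hRp.to_inf_left, mem_norm_inf hgR (le_normalizer hg)⟩
      have hle : R₀ ≤ R ⊓ H := sInf_le ⟨hR1, hxR, hx⟩
      have hmem : R₀ ∈ AA p H g := by
        rw [mem_AA]
        refine ⟨hle.trans inf_le_right, (hRp.to_inf_left).to_le hle, ?_⟩
        rw [mem_normalizer_iff]
        intro y
        simp only [hR₀, Subgroup.mem_sInf]
        apply forall_congr'
        intro T
        apply forall_congr'
        intro hT
        exact mem_normalizer_iff.1 (mem_AA.1 hT.1).2.2 y
      rw [← ee_sum _ _ hmem]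
      apply Finset.sum_congr _ (fun _ _ => rfl)
      ext T
      simp only [Finset.mem_filter]
      constructor
      · rintro ⟨a, b⟩
        exact ⟨a, sInf_le ⟨a, b⟩⟩
      · rintro ⟨a, b⟩
        refine ⟨a, b ?_⟩
        rw [hR₀, Subgroup.mem_sInf]
        exact fun S hS => hS.2
    · apply Finset.sum_eq_zero
      intro R hR
      rw [Finset.mem_filter, mem_AA] at hR
      exact absurd ⟨R, hR.1.2.1, hR.2, hR.1.2.2⟩ hex
  have h4 := h2.symm.trans h1
  rw [Finset.sum_congr rfl (fun g hg => h3 g (by simpa using hg))] at h4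
  rw [Finset.sum_boole, Finset.filter_filter] at h4
  exact_mod_cast h4

/-- Casolo's counting formula. -/
theorem casolo {p : ℕ} [Fact p.Prime] (H : Subgroup G) (x : G) (hx : x ∈ H) :
    (univ.filter (fun g => g ∈ H ∧ ∃ R : Subgroup G, IsPGroup p R ∧ x ∈ R ∧
      g ∈ normalizer (R : Set G))).card * (univ.filter (fun P => IsMx p H P)).card
    = (univ.filter (fun P : Subgroup G => IsMx p H P ∧ x ∈ P)).card * Nat.card H := by
  rw [casolo_sum H x hx, Finset.sum_mul, ← smul_eq_mul (Finset.card _), ← Finset.sum_const]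
  apply Finset.sum_congr rfl
  intro P hP
  rw [Finset.mem_filter] at hP
  rw [← mx_card_norm hP.2.1, card_mx, mul_comm]

/-- Comparison of Sylow counts in `G` and in a normal subgroup. -/
theorem mx_compare {p : ℕ} [Fact p.Prime] (N : Subgroup G) (hN : N.Normal) :
    ∃ c : ℕ, ∀ x ∈ N,
      (univ.filter (fun P : Subgroup G => IsMx p ⊤ P ∧ x ∈ P)).card
        = c * (univ.filter (fun P : Subgroup G => IsMx p N P ∧ x ∈ P)).card := by
  obtain ⟨T₀, hT₀, -⟩ := exists_mx (p := p) (H := N) (R := ⊥) bot_le IsPGroup.of_bot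
  have hfib : ∀ T, IsMx p N T →
      (univ.filter (fun P : Subgroup G => IsMx p ⊤ P ∧ P ⊓ N = T)).card
      ≤ (univ.filter (fun P : Subgroup G => IsMx p ⊤ P ∧ P ⊓ N = T₀)).card ∧
      (univ.filter (fun P : Subgroup G => IsMx p ⊤ P ∧ P ⊓ N = T₀)).card
      ≤ (univ.filter (fun P : Subgroup G => IsMx p ⊤ P ∧ P ⊓ N = T)).card := by
    have aux : ∀ T T', IsMx p N T → IsMx p N T' →
      (univ.filter (fun P : Subgroup G => IsMx p ⊤ P ∧ P ⊓ N = T)).card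
      ≤ (univ.filter (fun P : Subgroup G => IsMx p ⊤ P ∧ P ⊓ N = T')).card := by
      intro T T' hT hT'
      obtain ⟨n, hn, hc⟩ := mx_conj hT hT'
      apply Finset.card_le_card_of_injOn (cj n)
      · intro P hP
        simp only [Finset.coe_filter, Finset.mem_univ, true_and, Set.mem_ofPred_eq] at hP ⊢
        refine ⟨hP.1.cj' (cj_eq_of_mem (Subgroup.mem_top n)), ?_⟩
        rw [← hc, ← hP.2, cj_inf, cj_eq_of_mem hn]
      · exact (cj_inj n).injOn
    exact fun T hT => ⟨aux _ _ hT hT₀, aux _ _ hT₀ hT⟩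
  refine ⟨(univ.filter (fun P : Subgroup G => IsMx p ⊤ P ∧ P ⊓ N = T₀)).card, ?_⟩
  intro x hx
  rw [Finset.card_eq_sum_card_fiberwise (f := fun P => P ⊓ N)
    (t := univ.filter (fun P : Subgroup G => IsMx p N P ∧ x ∈ P))]
  · rw [mul_comm, ← smul_eq_mul, ← Finset.sum_const]
    apply Finset.sum_congr rfl
    intro T hT
    rw [Finset.mem_filter] at hT
    rw [← le_antisymm (hfib T hT.2.1).1 (hfib T hT.2.1).2, Finset.filter_filter]
    congr 1
    ext P
    simp only [Finset.mem_filter, Finset.mem_univ, true_and]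
    constructor
    · rintro ⟨⟨a, b⟩, c⟩; exact ⟨a, c⟩
    · rintro ⟨a, rfl⟩; exact ⟨⟨a, hT.2.2.1⟩, rfl⟩
  · intro P hP
    simp only [Finset.coe_filter, Finset.mem_univ, true_and, Set.mem_ofPred_eq] at hP ⊢
    refine ⟨mx_inf_normal le_top ?_ hP.1, hP.2, hx⟩
    rw [normalizer_eq_top]

end Count

section Subnormal

variable {G : Type*} [Group G]

theorem IsSubnormalIn.refl' (K : Subgroup G) : IsSubnormalIn K K :=
  ⟨0, fun _ => K, rfl, rfl, fun i => i.elim0⟩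

theorem IsSubnormalIn.cons' {H H' K : Subgroup G} (hle : H ≤ H')
    (hn : (H.subgroupOf H').Normal) (h : IsSubnormalIn H' K) : IsSubnormalIn H K := by
  obtain ⟨n, c, h0, h1, hc⟩ := h
  refine ⟨n + 1, Fin.cons H c, rfl, ?_, ?_⟩
  · rw [← Fin.succ_last, Fin.cons_succ, h1]
  · intro i
    refine Fin.cases ?_ (fun j => ?_) i
    · rw [Fin.castSucc_zero, Fin.cons_zero, Fin.cons_succ, h0]
      exact ⟨hle, hn⟩
    · rw [Fin.castSucc_succ, Fin.cons_succ, Fin.cons_succ]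
      exact hc j

theorem normal_subgroupOf_of_le {H K : Subgroup G} (h : K ≤ normalizer (H : Set G)) :
    (H.subgroupOf K).Normal := by
  constructor
  intro n hn g
  rw [mem_subgroupOf] at hn ⊢
  exact (mem_normalizer_iff.1 (h g.2) n).1 hn

theorem le_norm_of_normal {H K : Subgroup G} (hle : H ≤ K) (h : (H.subgroupOf K).Normal) :
    K ≤ normalizer (H : Set G) := by
  exact (Subgroup.normal_subgroupOf_iff_le_normalizer hle).1 h

theorem subnormal_of_pgroup [Finite G] {p : ℕ} [Fact p.Prime] {L K : Subgroup G}
    (hL : IsPGroup p L) (hLK : L ≤ K) (hn : K ≤ normalizer (L : Set G)) (H : Subgroup G) :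
    H ≤ L → IsSubnormalIn H K := by
  induction H using WellFoundedGT.induction with
  | ind H ih =>
    intro hH
    rcases hH.eq_or_lt with rfl | hlt
    · exact (IsSubnormalIn.refl' K).cons' hLK (normal_subgroupOf_of_le hn)
    · have h1 := norm_grow hL hlt
      exact (ih _ h1 inf_le_left).cons' h1.le (normal_subgroupOf_of_le inf_le_right)

theorem le_mx_of_subnormal [Finite G] {p : ℕ} [Fact p.Prime] {H K : Subgroup G}
    (hH : IsPGroup p H) (h : IsSubnormalIn H K) : ∀ P, IsMx p K P → H ≤ P := by
  obtain ⟨n, c, h0, h1, hc⟩ := h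
  have key : ∀ i : Fin (n + 1), ∀ P, IsMx p (c i) P → H ≤ P := by
    intro i
    induction i using Fin.induction with
    | zero =>
      intro P hP
      rw [h0] at hP
      exact (hP.2.2 H le_rfl hH hP.1).le
    | succ i ih =>
      intro P hP
      exact (ih _ (mx_inf_normal (hc i).1 (le_norm_of_normal (hc i).1 (hc i).2) hP)).trans
        inf_le_left
  intro P hP
  exact key (Fin.last n) P (h1 ▸ hP)

theorem subnormal_iff [Finite G] {p : ℕ} [Fact p.Prime] {x : G}
    (hx : IsPGroup p (zpowers x)) (g : G) :
    IsSubnormalIn (zpowers x) (zpowers x ⊔ zpowers g) ↔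
      ∃ R : Subgroup G, IsPGroup p R ∧ x ∈ R ∧ g ∈ normalizer (R : Set G) := by
  constructor
  · intro h
    set K := zpowers x ⊔ zpowers g with hK
    have hle := le_mx_of_subnormal hx h
    have hgK : g ∈ K := (le_sup_right : zpowers g ≤ K) (mem_zpowers g)
    obtain ⟨P₀, hP₀, -⟩ := exists_mx (p := p) (H := K) (R := ⊥) bot_le IsPGroup.of_bot
    refine ⟨sInf {P | IsMx p K P}, hP₀.2.1.to_le (sInf_le hP₀), ?_, ?_⟩
    · rw [Subgroup.mem_sInf]
      exact fun P hP => hle P hP (mem_zpowers x)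
    · rw [mem_normalizer_iff]
      intro y
      simp only [Subgroup.mem_sInf, Set.mem_ofPred_eq]
      constructor
      · intro hy P hP
        have := hy _ (hP.cj' (cj_eq_of_mem (K.inv_mem hgK)))
        rw [mem_cj] at this
        simpa using this
      · intro hy P hP
        have := hy _ (hP.cj' (cj_eq_of_mem hgK))
        rw [mem_cj] at this
        simpa [mul_assoc] using this
  · rintro ⟨R, hR, hxR, hgR⟩
    have hKR : zpowers x ⊔ zpowers g ≤ normalizer (R : Set G) := by
      refine sup_le ?_ ?_
      · rw [zpowers_le]; exact le_normalizer hxR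
      · rw [zpowers_le]; exact hgR
    refine subnormal_of_pgroup (p := p) (L := R ⊓ (zpowers x ⊔ zpowers g)) hR.to_inf_left
      inf_le_right ?_ _ (le_inf ?_ le_sup_left)
    · intro k hk
      rw [mem_norm_iff, cj_inf, mem_norm_iff.1 (hKR hk), cj_eq_of_mem hk]
    · rw [zpowers_le]; exact hxR

end Subnormal

/-- If `N ⊴ G` and `x ∈ N` is a `p`-element, then `|S_G(x)| · |N| = |S_N(x)| · |G|`. -/
theorem card_subnormalizer_mul_card_eq {G : Type*} [Group G] [Fintype G]
    (p : ℕ) (hp : p.Prime) (N : Subgroup G) (hN : N.Normal)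
    (x : G) (hx : x ∈ N) (hxp : ∃ m : ℕ, orderOf x = p ^ m) :
    Nat.card (subnormalizerSet x) * Nat.card N =
      Nat.card (subnormalizerSetIn N x) * Nat.card G := by
  classical
  haveI : Fact p.Prime := ⟨hp⟩
  haveI : Fintype (Subgroup G) := Fintype.ofFinite _
  obtain ⟨m, hm⟩ := hxp
  have hxP : IsPGroup p (zpowers x) := IsPGroup.of_card (n := m) (by rw [Nat.card_zpowers, hm])
  have hG := casolo (p := p) (⊤ : Subgroup G) x (Subgroup.mem_top x)
  have hNN := casolo (p := p) N x hx
  obtain ⟨c, hc⟩ := mx_compare (p := p) N hN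
  have hcx := hc x hx
  have hc1 := hc 1 N.one_mem
  simp only [Subgroup.one_mem, and_true] at hc1
  have e1 : Nat.card (subnormalizerSet x) = (Finset.univ.filter (fun g => g ∈ (⊤ : Subgroup G) ∧
      ∃ R : Subgroup G, IsPGroup p R ∧ x ∈ R ∧ g ∈ normalizer (R : Set G))).card := by
    rw [← Fintype.card_subtype, ← Nat.card_eq_fintype_card]
    apply Nat.card_congr
    apply Equiv.subtypeEquivRight
    intro g
    rw [← subnormal_iff hxP g]
    exact ⟨fun h => ⟨Subgroup.mem_top g, h⟩, fun h => h.2⟩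
  have e2 : Nat.card (subnormalizerSetIn N x) = (Finset.univ.filter (fun g => g ∈ N ∧
      ∃ R : Subgroup G, IsPGroup p R ∧ x ∈ R ∧ g ∈ normalizer (R : Set G))).card := by
    rw [← Fintype.card_subtype, ← Nat.card_eq_fintype_card]
    apply Nat.card_congr
    apply Equiv.subtypeEquivRight
    intro g
    rw [← subnormal_iff hxP g]
    exact Iff.rfl
  obtain ⟨P₀, hP₀, -⟩ := exists_mx (p := p) (H := (⊤ : Subgroup G)) (R := ⊥) bot_le IsPGroup.of_bot
  have hpos : 0 < (Finset.univ.filter (fun P : Subgroup G => IsMx p ⊤ P)).card :=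
    Finset.card_pos.2 ⟨P₀, by simp [hP₀]⟩
  rw [← e1, hcx, hc1, Subgroup.card_top] at hG
  rw [← e2] at hNN
  rw [hc1] at hpos
  generalize (Finset.univ.filter (fun P : Subgroup G => IsMx p N P)).card = nN at *
  generalize (Finset.univ.filter (fun P : Subgroup G => IsMx p N P ∧ x ∈ P)).card = lN at *
  apply Nat.eq_of_mul_eq_mul_left hpos
  calc c * nN * (Nat.card (subnormalizerSet x) * Nat.card N)
      = (Nat.card (subnormalizerSet x) * (c * nN)) * Nat.card N := by ring
    _ = c * Nat.card G * (lN * Nat.card N) := by rw [hG]; ring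
    _ = c * nN * (Nat.card (subnormalizerSetIn N x) * Nat.card G) := by rw [← hNN]; ring
end
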